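/- arXiv:1304.4198 — 3 statements merged into one kernel-verified Lean document; each statement's English description precedes it below -/
import Mathlib

section
/- Let u : 𝔻 → ℝ be real analytic and hyperbolically convex. If the gradient of u vanishes at two distinct points z₁ ≠ z₂ of 𝔻, then u is constant along the entire hyperbolic geodesic of 𝔻 through z₁ and z₂. -/
open Complex Metric

/-- A function `u` on the unit disk is hyperbolically convex if it is convex along every
hyperbolic geodesic, parametrized by hyperbolic arclength; equivalently, for every
holomorphic automorphism `M` of the disk, `s ↦ u (M (tanh s))` is convex on `ℝ`. -/
def HypConvexOn (u : ℂ → ℝ) : Prop :=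
  ∀ M : ℂ → ℂ, DifferentiableOn ℂ M (ball (0:ℂ) 1) →
    Set.BijOn M (ball (0:ℂ) 1) (ball (0:ℂ) 1) →
    ConvexOn ℝ Set.univ fun s : ℝ => u (M (Real.tanh s))

open Filter Topology

/-- A critical point of a convex function on `ℝ` is a global minimum. -/
theorem ConvexOn.isMinOn_univ_of_hasDerivAt_zero {f : ℝ → ℝ} {a : ℝ}
    (hf : ConvexOn ℝ Set.univ f) (ha : HasDerivAt f 0 a) : IsMinOn f Set.univ a :=
  hf.isMinOn_of_rightDeriv_eq_zero (by simp)
    (ha.hasDerivWithinAt.derivWithin (uniqueDiffWithinAt_Ioi a))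

/-- A real-analytic convex function on `ℝ` with two distinct critical points is constant. -/
theorem ConvexOn.eq_of_analyticOnNhd_of_two_critical_points {f : ℝ → ℝ} {a b : ℝ}
    (hf : ConvexOn ℝ Set.univ f) (hfa : AnalyticOnNhd ℝ f Set.univ) (hab : a ≠ b)
    (ha : HasDerivAt f 0 a) (hb : HasDerivAt f 0 b) (x : ℝ) : f x = f a := by
  wlog hlt : a < b generalizing a b
  · rw [this hab.symm hb ha (lt_of_le_of_ne (not_lt.mp hlt) hab.symm)]
    exact le_antisymm (hf.isMinOn_univ_of_hasDerivAt_zero hb (Set.mem_univ a))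
      (hf.isMinOn_univ_of_hasDerivAt_zero ha (Set.mem_univ b))
  have hmin := hf.isMinOn_univ_of_hasDerivAt_zero ha
  have hba : f b ≤ f a := hf.isMinOn_univ_of_hasDerivAt_zero hb (Set.mem_univ a)
  obtain ⟨c, hac, hcb⟩ := exists_between hlt
  have hloc : f =ᶠ[𝓝 c] fun _ => f a := by
    filter_upwards [Ioo_mem_nhds hac hcb] with y hy
    refine le_antisymm ?_ (hmin (Set.mem_univ y))
    have := hf.le_max_of_mem_Icc (Set.mem_univ a) (Set.mem_univ b) (Set.Ioo_subset_Icc_self hy)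
    simpa [max_eq_left hba] using this
  exact congrFun (hfa.eq_of_eventuallyEq analyticOnNhd_const hloc) x

theorem Real.analyticAt_tanh (s : ℝ) : AnalyticAt ℝ Real.tanh s := by
  have h : Real.tanh = fun t => Real.sinh t / Real.cosh t :=
    funext Real.tanh_eq_sinh_div_cosh
  rw [h]
  exact Real.contDiff_sinh.contDiffAt.analyticAt.div Real.contDiff_cosh.contDiffAt.analyticAt
    (Real.cosh_pos s).ne'

theorem Complex.ofReal_tanh_mem_ball (s : ℝ) : (Real.tanh s : ℂ) ∈ ball (0 : ℂ) 1 := by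
  rw [mem_ball_zero_iff, Complex.norm_real]
  exact Real.abs_tanh_lt_one s

/-- A holomorphic map on the disk is real analytic along `s ↦ tanh s`. -/
theorem DifferentiableOn.analyticAt_comp_tanh {M : ℂ → ℂ}
    (hM : DifferentiableOn ℂ M (ball (0 : ℂ) 1)) (s : ℝ) :
    AnalyticAt ℝ (fun t : ℝ => M (Real.tanh t)) s := by
  have htanh : AnalyticAt ℝ (fun t : ℝ => (Real.tanh t : ℂ)) s :=
    (Complex.ofRealCLM.analyticAt (Real.tanh s)).fun_comp (Real.analyticAt_tanh s)
  have hMs : AnalyticAt ℝ M (Real.tanh s : ℂ) :=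
    (hM.analyticAt (isOpen_ball.mem_nhds (Complex.ofReal_tanh_mem_ball s))).restrictScalars
  exact AnalyticAt.comp (g := M) (f := fun t : ℝ => (Real.tanh t : ℂ)) hMs htanh

/-- A real-analytic, hyperbolically convex function on the disk whose gradient vanishes at
two distinct points is constant along the hyperbolic geodesic through those points
(any geodesic through the two points being parametrized as `s ↦ M (tanh s)` for an
automorphism `M` of the disk). -/
theorem constant_on_geodesic_of_two_critical_points (u : ℂ → ℝ)
    (hu : AnalyticOnNhd ℝ u (ball (0:ℂ) 1))
    (hconv : HypConvexOn u)
    (z₁ z₂ : ℂ) (hz₁ : z₁ ∈ ball (0:ℂ) 1) (hz₂ : z₂ ∈ ball (0:ℂ) 1)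
    (hne : z₁ ≠ z₂)
    (hc₁ : fderiv ℝ u z₁ = 0) (hc₂ : fderiv ℝ u z₂ = 0) :
    ∀ M : ℂ → ℂ, DifferentiableOn ℂ M (ball (0:ℂ) 1) →
      Set.BijOn M (ball (0:ℂ) 1) (ball (0:ℂ) 1) →
      ∀ s₁ s₂ : ℝ, M (Real.tanh s₁) = z₁ → M (Real.tanh s₂) = z₂ →
        ∀ s : ℝ, u (M (Real.tanh s)) = u z₁ := by
  intro M hM hbij s₁ s₂ h₁ h₂ s
  have hcrit : ∀ t : ℝ, fderiv ℝ u (M (Real.tanh t)) = 0 →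
      HasDerivAt (fun s : ℝ => u (M (Real.tanh s))) 0 t := by
    intro t ht
    have hut := (hu _ (hbij.mapsTo (ofReal_tanh_mem_ball t))).differentiableAt.hasFDerivAt
    rw [ht] at hut
    simpa [Function.comp_def] using hut.comp_hasDerivAt t (hM.analyticAt_comp_tanh t).differentiableAt.hasDerivAt
  rw [← h₁]
  refine (hconv M hM hbij).eq_of_analyticOnNhd_of_two_critical_points (fun t _ => ?_)
    (fun h => hne ?_) (hcrit s₁ (h₁ ▸ hc₁)) (hcrit s₂ (h₂ ▸ hc₂)) s
  · exact AnalyticAt.comp (hu _ (hbij.mapsTo (ofReal_tanh_mem_ball t)))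
      (hM.analyticAt_comp_tanh t)
  · rw [← h₁, ← h₂, h]
end

section
/- Fix a > √2. Define n₀(t) = (1/√2)·((1+t)^{√2} - (1-t)^{√2})/((1+t)^{√2} + (1-t)^{√2}) for t ∈ [0,1). There is a unique t₀ ∈ (0,1) with a·n₀(t₀) = 1; on [0,t₀) define n(t) = n₀(t)/(1 - a·n₀(t)) and y(t) = n''(t)/(2n'(t)). Then y satisfies the Riccati equation y'(t) = y(t)² - 1/(1-t²)² with y(0) = a, y is increasing on [0,t₀), and y(t) → ∞ as t → t₀ from the left. -/
open Real Filter

/-- The comparison function `n₀(t) = (1/√2)((1+t)^√2 - (1-t)^√2)/((1+t)^√2 + (1-t)^√2)`. -/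
noncomputable def nzero (t : ℝ) : ℝ :=
  (Real.sqrt 2)⁻¹ * (((1+t) ^ (Real.sqrt 2) - (1-t) ^ (Real.sqrt 2)) /
    ((1+t) ^ (Real.sqrt 2) + (1-t) ^ (Real.sqrt 2)))

/-- `n(t) = n₀(t)/(1 - a·n₀(t))`. -/
noncomputable def nfun (a t : ℝ) : ℝ := nzero t / (1 - a * nzero t)

/-- `y(t) = n''(t)/(2 n'(t))`, solution of the Riccati comparison equation. -/
noncomputable def yfun (a t : ℝ) : ℝ := deriv (deriv (nfun a)) t / (2 * deriv (nfun a) t)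

/-- Up to the factor `√2 ((1+t)^√2 + (1-t)^√2)`, the denominator `1 - a n₀(t)`. -/
noncomputable def denom (a t : ℝ) : ℝ :=
  (a + √2) * (1 - t) ^ √2 - (a - √2) * (1 + t) ^ √2

/-- Closed form of `y = n'' / (2 n')`. -/
noncomputable def yclosed (a t : ℝ) : ℝ :=
  (t + √2 * ((a + √2) * (1 - t) ^ √2 + (a - √2) * (1 + t) ^ √2) / denom a t) / (1 - t ^ 2)

/-- Closed form of `n'`. -/
noncomputable def nderivClosed (a t : ℝ) : ℝ :=
  8 * ((1 + t) ^ √2 * (1 - t) ^ √2) / ((1 - t ^ 2) * denom a t ^ 2)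

lemma hasDerivAt_one_add_rpow (s : ℝ) {t : ℝ} (h : -1 < t) :
    HasDerivAt (fun x : ℝ => (1 + x) ^ s) (s * (1 + t) ^ s / (1 + t)) t := by
  have h1 : (1 + t) ≠ 0 := by linarith
  have := ((hasDerivAt_id' t).const_add 1).rpow_const (p := s) (Or.inl h1)
  refine this.congr_deriv ?_
  rw [rpow_sub_one h1]
  ring

lemma hasDerivAt_one_sub_rpow (s : ℝ) {t : ℝ} (h : t < 1) :
    HasDerivAt (fun x : ℝ => (1 - x) ^ s) (-(s * (1 - t) ^ s / (1 - t))) t := by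
  have h1 : (1 - t) ≠ 0 := by linarith
  have := ((hasDerivAt_id' t).const_sub 1).rpow_const (p := s) (Or.inl h1)
  refine this.congr_deriv ?_
  rw [rpow_sub_one h1]
  ring

lemma hasDerivAt_denom (a : ℝ) {t : ℝ} (h : -1 < t) (h' : t < 1) :
    HasDerivAt (denom a) ((a + √2) * -(√2 * (1 - t) ^ √2 / (1 - t)) -
      (a - √2) * (√2 * (1 + t) ^ √2 / (1 + t))) t :=
  ((hasDerivAt_one_sub_rpow _ h').const_mul _).sub ((hasDerivAt_one_add_rpow _ h).const_mul _)

lemma one_sub_mul_nzero (a : ℝ) {t : ℝ} (h : -1 < t) (h' : t < 1) :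
    1 - a * nzero t = denom a t / (√2 * ((1 + t) ^ √2 + (1 - t) ^ √2)) := by
  have hP : 0 < (1 + t) ^ √2 := rpow_pos_of_pos (by linarith) _
  have hQ : 0 < (1 - t) ^ √2 := rpow_pos_of_pos (by linarith) _
  have hs : 0 < √2 := by positivity
  unfold nzero denom
  field_simp
  ring

lemma nfun_eq (a : ℝ) {t : ℝ} (h : -1 < t) (h' : t < 1) :
    nfun a t = ((1 + t) ^ √2 - (1 - t) ^ √2) / denom a t := by
  have hP : 0 < (1 + t) ^ √2 := rpow_pos_of_pos (by linarith) _
  have hQ : 0 < (1 - t) ^ √2 := rpow_pos_of_pos (by linarith) _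
  have hs : 0 < √2 := by positivity
  rw [nfun, one_sub_mul_nzero a h h', nzero]
  field_simp

lemma denom_strictAntiOn {a : ℝ} (ha : √2 < a) : StrictAntiOn (denom a) (Set.Icc (-1) 1) := by
  intro x hx y hy hxy
  have hs : 0 < √2 := by positivity
  have h1 : (1 + x) ^ √2 < (1 + y) ^ √2 :=
    rpow_lt_rpow (by linarith [hx.1]) (by linarith) hs
  have h2 : (1 - y) ^ √2 < (1 - x) ^ √2 :=
    rpow_lt_rpow (by linarith [hy.2]) (by linarith) hs
  have h3 := mul_lt_mul_of_pos_left h1 (sub_pos.2 ha)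
  have h4 := mul_lt_mul_of_pos_left h2 (show 0 < a + √2 by linarith)
  unfold denom
  linarith

lemma continuous_denom (a : ℝ) : Continuous (denom a) := by
  have hs : 0 ≤ √2 := by positivity
  unfold denom
  exact ((continuous_const.mul ((continuous_const.sub continuous_id).rpow_const
    fun _ => Or.inr hs)).sub (continuous_const.mul
      ((continuous_const.add continuous_id).rpow_const fun _ => Or.inr hs)))

lemma exists_denom_eq_zero {a : ℝ} (ha : √2 < a) : ∃ t ∈ Set.Ioo (0 : ℝ) 1, denom a t = 0 := by
  have hs : 0 < √2 := by positivity
  have h0 : 0 < denom a 0 := by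
    simp only [denom, sub_zero, add_zero, one_rpow]
    linarith
  have h1 : denom a 1 < 0 := by
    have : 0 < (1 + 1 : ℝ) ^ √2 := by positivity
    simp only [denom, sub_self, zero_rpow hs.ne']
    nlinarith
  exact intermediate_value_Ioo' zero_le_one (continuous_denom a).continuousOn ⟨h1, h0⟩

lemma hasDerivAt_nfun {a t : ℝ} (h : -1 < t) (h' : t < 1) (hE : denom a t ≠ 0) :
    HasDerivAt (nfun a) (nderivClosed a t) t := by
  have hq := ((hasDerivAt_one_add_rpow √2 h).sub (hasDerivAt_one_sub_rpow √2 h')).div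
    (hasDerivAt_denom a h h') hE
  have heq : nfun a =ᶠ[nhds t] fun x => ((1 + x) ^ √2 - (1 - x) ^ √2) / denom a x := by
    filter_upwards [Ioo_mem_nhds h h'] with x hx using nfun_eq a hx.1 hx.2
  refine HasDerivAt.congr_of_eventuallyEq ?_ heq
  refine hq.congr_deriv ?_
  have hs : √2 ^ 2 = 2 := sq_sqrt (by norm_num)
  have h1 : 1 + t ≠ 0 := by linarith
  have h2 : 1 - t ≠ 0 := by linarith
  have h3 : 1 - t ^ 2 = (1 + t) * (1 - t) := by ring
  rw [nderivClosed, h3]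
  simp only [Pi.sub_apply]
  field_simp
  unfold denom
  generalize (1 + t) ^ √2 = P
  generalize (1 - t) ^ √2 = Q
  generalize √2 = s at *
  linear_combination (4 * P * Q) * hs

lemma hasDerivAt_nderivClosed {a t : ℝ} (h : -1 < t) (h' : t < 1) (hE : denom a t ≠ 0) :
    HasDerivAt (nderivClosed a) (2 * yclosed a t * nderivClosed a t) t := by
  have h1 : 1 + t ≠ 0 := by linarith
  have h2 : 1 - t ≠ 0 := by linarith
  have h3 : 1 - t ^ 2 = (1 + t) * (1 - t) := by ring
  have h4 : 1 - t ^ 2 ≠ 0 := by rw [h3]; positivity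
  have hq := (((hasDerivAt_one_add_rpow √2 h).mul (hasDerivAt_one_sub_rpow √2 h')).const_mul 8).div
    ((((hasDerivAt_id t).pow 2).const_sub 1).mul ((hasDerivAt_denom a h h').pow 2))
    (mul_ne_zero h4 (pow_ne_zero 2 hE))
  refine hq.congr_deriv ?_
  simp only [Pi.mul_apply, Pi.pow_apply, id, yclosed, nderivClosed, h3]
  field_simp
  unfold denom
  generalize (1 + t) ^ √2 = P
  generalize (1 - t) ^ √2 = Q
  generalize √2 = s at *
  push_cast
  ring

lemma hasDerivAt_yclosed {a t : ℝ} (h : -1 < t) (h' : t < 1) (hE : denom a t ≠ 0) :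
    HasDerivAt (yclosed a) (yclosed a t ^ 2 - 1 / (1 - t ^ 2) ^ 2) t := by
  have h1 : 1 + t ≠ 0 := by linarith
  have h2 : 1 - t ≠ 0 := by linarith
  have h3 : 1 - t ^ 2 = (1 + t) * (1 - t) := by ring
  have h4 : 1 - t ^ 2 ≠ 0 := by rw [h3]; positivity
  have hs : √2 ^ 2 = 2 := sq_sqrt (by norm_num)
  have hq := ((hasDerivAt_id t).add ((((hasDerivAt_one_sub_rpow √2 h').const_mul (a + √2)).add
    ((hasDerivAt_one_add_rpow √2 h).const_mul (a - √2))).const_mul √2 |>.div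
      (hasDerivAt_denom a h h') hE)).div (((hasDerivAt_id t).pow 2).const_sub 1) h4
  refine hq.congr_deriv ?_
  simp only [Pi.add_apply, Pi.div_apply, Pi.pow_apply, id, yclosed, h3]
  field_simp
  unfold denom
  generalize (1 + t) ^ √2 = P
  generalize (1 - t) ^ √2 = Q
  generalize √2 = s at *
  push_cast
  linear_combination (-(s * (P + Q) - a * (P - Q)) ^ 2) * hs

lemma one_div_lt_yclosed {a t : ℝ} (ha : √2 < a) (h : 0 ≤ t) (h' : t < 1)
    (hE : 0 < denom a t) : 1 / (1 - t ^ 2) < yclosed a t := by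
  have hP : 0 < (1 + t) ^ √2 := rpow_pos_of_pos (by linarith) _
  have hs : 1 < √2 := by
    rw [lt_sqrt] <;> norm_num
  have h4 : 0 < 1 - t ^ 2 := by nlinarith
  unfold yclosed
  gcongr
  have : √2 ≤ √2 * ((a + √2) * (1 - t) ^ √2 + (a - √2) * (1 + t) ^ √2) / denom a t := by
    rw [le_div_iff₀ hE]
    gcongr
    unfold denom
    have := mul_pos (sub_pos.2 ha) hP
    linarith
  linarith

lemma yfun_eq_yclosed {a t t₀ : ℝ} (h : -1 < t) (h' : t < t₀) (h₀ : t₀ < 1)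
    (hE : ∀ x ∈ Set.Ioo (-1) t₀, 0 < denom a x) : yfun a t = yclosed a t := by
  have hpos : 0 < nderivClosed a t := by
    have hP : 0 < (1 + t) ^ √2 := rpow_pos_of_pos (by linarith) _
    have hQ : 0 < (1 - t) ^ √2 := rpow_pos_of_pos (by linarith) _
    have h4 : 0 < 1 - t ^ 2 := by nlinarith
    have := hE t ⟨h, h'⟩
    unfold nderivClosed
    positivity
  have heq : deriv (nfun a) =ᶠ[nhds t] nderivClosed a := by
    filter_upwards [Ioo_mem_nhds h h'] with x hx
    exact (hasDerivAt_nfun hx.1 (hx.2.trans h₀) (hE x hx).ne').deriv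
  rw [yfun, heq.deriv_eq, heq.eq_of_nhds,
    (hasDerivAt_nderivClosed h (h'.trans h₀) (hE t ⟨h, h'⟩).ne').deriv]
  field_simp

lemma tendsto_yclosed {a t₀ : ℝ} (ha : √2 < a) (h0 : 0 < t₀) (h1 : t₀ < 1)
    (hz : denom a t₀ = 0) (hE : ∀ x ∈ Set.Ioo (-1) t₀, 0 < denom a x) :
    Tendsto (yclosed a) (nhdsWithin t₀ (Set.Iio t₀)) atTop := by
  have hs : 0 < √2 := by positivity
  have hP : 0 < (1 + t₀) ^ √2 := rpow_pos_of_pos (by linarith) _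
  have hQ : 0 < (1 - t₀) ^ √2 := rpow_pos_of_pos (by linarith) _
  have h4 : 0 < 1 - t₀ ^ 2 := by nlinarith
  have hden : Tendsto (denom a) (nhdsWithin t₀ (Set.Iio t₀)) (nhdsWithin 0 (Set.Ioi 0)) := by
    refine tendsto_nhdsWithin_iff.2 ⟨?_, ?_⟩
    · rw [← hz]
      exact (continuous_denom a).continuousAt.tendsto.mono_left nhdsWithin_le_nhds
    · filter_upwards [Ioo_mem_nhdsLT (show -1 < t₀ by linarith)] with x hx using hE x hx
  have hnum : Tendsto (fun t : ℝ => √2 * ((a + √2) * (1 - t) ^ √2 + (a - √2) * (1 + t) ^ √2))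
      (nhdsWithin t₀ (Set.Iio t₀))
      (nhds (√2 * ((a + √2) * (1 - t₀) ^ √2 + (a - √2) * (1 + t₀) ^ √2))) := by
    refine (((((hasDerivAt_one_sub_rpow √2 h1).const_mul (a + √2)).add
      ((hasDerivAt_one_add_rpow √2 (by linarith)).const_mul (a - √2))).const_mul
        √2).continuousAt.tendsto).mono_left nhdsWithin_le_nhds
  have hnumpos : 0 < √2 * ((a + √2) * (1 - t₀) ^ √2 + (a - √2) * (1 + t₀) ^ √2) := by
    have := sub_pos.2 ha
    have := hs.trans ha
    positivity
  have hid : Tendsto (fun t : ℝ => t) (nhdsWithin t₀ (Set.Iio t₀)) (nhds t₀) :=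
    tendsto_id.mono_left nhdsWithin_le_nhds
  have hinv : Tendsto (fun t : ℝ => (1 - t ^ 2)⁻¹) (nhdsWithin t₀ (Set.Iio t₀))
      (nhds (1 - t₀ ^ 2)⁻¹) := ((hid.pow 2).const_sub 1).inv₀ h4.ne'
  have hquot := hnum.pos_mul_atTop hnumpos (tendsto_inv_nhdsGT_zero.comp hden)
  exact (hid.add_atTop hquot).atTop_mul_pos (inv_pos.2 h4) hinv

/-- For `a > √2` there is a unique `t₀ ∈ (0,1)` with `a·n₀(t₀) = 1`, and
`y = n''/(2n')` solves `y' = y² - 1/(1-t²)²` with `y(0) = a`, is increasing on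
`[0,t₀)`, and blows up to `+∞` as `t → t₀⁻`. -/
theorem riccati_comparison_blowup (a : ℝ) (ha : Real.sqrt 2 < a) :
    ∃ t₀ ∈ Set.Ioo (0:ℝ) 1, a * nzero t₀ = 1 ∧
      (∀ t ∈ Set.Ioo (0:ℝ) 1, a * nzero t = 1 → t = t₀) ∧
      yfun a 0 = a ∧
      (∀ t ∈ Set.Ico (0:ℝ) t₀,
        deriv (yfun a) t = (yfun a t)^2 - 1/(1-t^2)^2) ∧
      StrictMonoOn (yfun a) (Set.Ico (0:ℝ) t₀) ∧
      Tendsto (yfun a) (nhdsWithin t₀ (Set.Iio t₀)) atTop := by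
  have hs : 0 < √2 := by positivity
  obtain ⟨t₀, ⟨h0, h1⟩, hz⟩ := exists_denom_eq_zero ha
  have hanti := denom_strictAntiOn ha
  have hE : ∀ x ∈ Set.Ioo (-1) t₀, 0 < denom a x := fun x hx => by
    rw [← hz]
    exact hanti ⟨hx.1.le, by linarith [hx.2]⟩ ⟨by linarith, h1.le⟩ hx.2
  have hy : ∀ x ∈ Set.Ioo (-1) t₀, yfun a x = yclosed a x := fun x hx =>
    yfun_eq_yclosed hx.1 hx.2 h1 hE
  have hyd : ∀ t ∈ Set.Ico (0:ℝ) t₀,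
      HasDerivAt (yfun a) (yfun a t ^ 2 - 1 / (1 - t ^ 2) ^ 2) t := fun t ht => by
    have ht' : t ∈ Set.Ioo (-1) t₀ := ⟨by linarith [ht.1], ht.2⟩
    rw [hy t ht']
    refine (hasDerivAt_yclosed ht'.1 (ht.2.trans h1) (hE t ht').ne').congr_of_eventuallyEq ?_
    filter_upwards [Ioo_mem_nhds ht'.1 ht'.2] with x hx using hy x hx
  refine ⟨t₀, ⟨h0, h1⟩, ?_, fun t ht hat => ?_, ?_, fun t ht => (hyd t ht).deriv, ?_, ?_⟩
  · have := one_sub_mul_nzero a (by linarith) h1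
    rw [hz, zero_div] at this
    linarith
  · have hP : 0 < (1 + t) ^ √2 := rpow_pos_of_pos (by linarith [ht.1]) _
    have hQ : 0 < (1 - t) ^ √2 := rpow_pos_of_pos (by linarith [ht.2]) _
    have hd := one_sub_mul_nzero a (by linarith [ht.1]) ht.2
    rw [hat, sub_self, eq_comm, div_eq_zero_iff, or_iff_left (by positivity), ← hz] at hd
    exact hanti.injOn ⟨by linarith [ht.1], ht.2.le⟩ ⟨by linarith, h1.le⟩ hd
  · rw [hy 0 ⟨by norm_num, h0⟩]
    simp only [yclosed, denom, sub_zero, add_zero, one_rpow]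
    field_simp
    ring
  · refine strictMonoOn_of_deriv_pos (convex_Ico 0 t₀)
      (fun t ht => (hyd t ht).continuousAt.continuousWithinAt) fun t ht => ?_
    rw [interior_Ico] at ht
    have ht' : t ∈ Set.Ioo (-1) t₀ := ⟨by linarith [ht.1], ht.2⟩
    have h4 : 0 < 1 - t ^ 2 := by nlinarith [ht.1, ht.2]
    rw [(hyd t ⟨ht.1.le, ht.2⟩).deriv, hy t ht', sub_pos, ← one_div_pow]
    exact pow_lt_pow_left₀ (one_div_lt_yclosed ha ht.1.le (ht.2.trans h1) (hE t ht'))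
      (by positivity) two_ne_zero
  · refine (tendsto_yclosed ha h0 h1 hz hE).congr' ?_
    filter_upwards [Ioo_mem_nhdsLT (show -1 < t₀ by linarith)] with x hx using (hy x hx).symm
end

section
/- Let P : (-1,1) → ℝ be continuous with P(x) ≤ 1/(1-x²)² for all x ∈ (-1,1), and let V : (-1,1) → (0,∞) be twice continuously differentiable with V''(x) + P(x)V(x) = 0. Then the function s ↦ V(tanh s)·cosh s (that is, W(x) = V(x)/√(1-x²) evaluated at x = tanh s, the hyperbolic arclength parametrization of (-1,1)) is convex on ℝ. -/
theorem Real.hasDerivAt_tanh (s : ℝ) : HasDerivAt Real.tanh (1 / Real.cosh s ^ 2) s := by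
  have h := (Real.hasDerivAt_sinh s).div (Real.hasDerivAt_cosh s) (Real.cosh_pos s).ne'
  have hfun : Real.tanh = Real.sinh / Real.cosh := funext Real.tanh_eq_sinh_div_cosh
  rw [hfun]
  refine h.congr_deriv (congrArg (· / Real.cosh s ^ 2) ?_)
  linarith [Real.cosh_sq s]

theorem Real.one_sub_tanh_sq (s : ℝ) : 1 - Real.tanh s ^ 2 = 1 / Real.cosh s ^ 2 := by
  have hc := (Real.cosh_pos s).ne'
  rw [Real.tanh_eq_sinh_div_cosh]
  field_simp
  linarith [Real.cosh_sq s]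


/-- Convexity in the hyperbolic arclength parameter of `W(x) = V(x)/√(1-x²)` for a
positive solution of `V'' + PV = 0` with `P ≤ 1/(1-x²)²`: the function
`s ↦ V(tanh s)·cosh s` is convex on `ℝ`. -/
theorem convexity_from_comparison (P V : ℝ → ℝ)
    (hP : ContinuousOn P (Set.Ioo (-1:ℝ) 1))
    (hPle : ∀ x ∈ Set.Ioo (-1:ℝ) 1, P x ≤ 1 / (1 - x^2)^2)
    (hV : ContDiffOn ℝ 2 V (Set.Ioo (-1:ℝ) 1))
    (hVpos : ∀ x ∈ Set.Ioo (-1:ℝ) 1, 0 < V x)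
    (hODE : ∀ x ∈ Set.Ioo (-1:ℝ) 1, deriv (deriv V) x + P x * V x = 0) :
    ConvexOn ℝ Set.univ fun s : ℝ => V (Real.tanh s) * Real.cosh s := by
  have hmem (s : ℝ) : Real.tanh s ∈ Set.Ioo (-1:ℝ) 1 :=
    ⟨Real.neg_one_lt_tanh s, Real.tanh_lt_one s⟩
  have hV' (x : ℝ) (hx : x ∈ Set.Ioo (-1:ℝ) 1) : HasDerivAt V (deriv V x) x :=
    ((hV.differentiableOn (by norm_num)).differentiableAt (isOpen_Ioo.mem_nhds hx)).hasDerivAt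
  have hdV : ContDiffOn ℝ 1 (deriv V) (Set.Ioo (-1:ℝ) 1) :=
    hV.deriv_of_isOpen isOpen_Ioo (by norm_num)
  have hV'' (x : ℝ) (hx : x ∈ Set.Ioo (-1:ℝ) 1) :
      HasDerivAt (deriv V) (-(P x * V x)) x := by
    rw [← eq_neg_of_add_eq_zero_left (hODE x hx)]
    exact ((hdV.differentiableOn (by norm_num)).differentiableAt
      (isOpen_Ioo.mem_nhds hx)).hasDerivAt
  have hW' (s : ℝ) : HasDerivAt (fun s => V (Real.tanh s) * Real.cosh s)
      (deriv V (Real.tanh s) / Real.cosh s + V (Real.tanh s) * Real.sinh s) s := by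
    have h := ((hV' _ (hmem s)).comp s (Real.hasDerivAt_tanh s)).mul (Real.hasDerivAt_cosh s)
    have hc := (Real.cosh_pos s).ne'
    refine h.congr_deriv ?_
    simp only [Function.comp_apply]
    field_simp
  have hW'' (s : ℝ) : HasDerivAt
      (fun s => deriv V (Real.tanh s) / Real.cosh s + V (Real.tanh s) * Real.sinh s)
      (V (Real.tanh s) * (Real.cosh s ^ 4 - P (Real.tanh s)) / Real.cosh s ^ 3) s := by
    have h := (((hV'' _ (hmem s)).comp s (Real.hasDerivAt_tanh s)).div
      (Real.hasDerivAt_cosh s) (Real.cosh_pos s).ne').add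
      (((hV' _ (hmem s)).comp s (Real.hasDerivAt_tanh s)).mul (Real.hasDerivAt_sinh s))
    have hc := (Real.cosh_pos s).ne'
    refine h.congr_deriv ?_
    simp only [Function.comp_apply]
    field_simp
    ring
  refine convexOn_of_hasDerivWithinAt2_nonneg convex_univ
    (fun s _ => (hW' s).continuousAt.continuousWithinAt)
    (fun s _ => (hW' s).hasDerivWithinAt) (fun s _ => (hW'' s).hasDerivWithinAt) fun s _ => ?_
  have hle : P (Real.tanh s) ≤ Real.cosh s ^ 4 := by
    refine (hPle _ (hmem s)).trans_eq ?_
    have hc := (Real.cosh_pos s).ne'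
    rw [Real.one_sub_tanh_sq]
    field_simp
  exact div_nonneg (mul_nonneg (hVpos _ (hmem s)).le (sub_nonneg.2 hle))
    (pow_nonneg (Real.cosh_pos s).le 3)
end
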